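/- Under Assumption A, a point x ∈ X^⋄ equals x^{*,□} (the unique minimizer of L^□ over X^⋄) if and only if there exist vectors ν ∈ ℝ^I and β ∈ ℝ^S such that x̄ has the product form x_k = (e^{−β_s}/c_k)·exp(Σ_i k_i ν_i) for every s ∈ 𝓢 and every k ∈ K̄^s (including the zero configurations, for which x_{0^s} = e^{−β_s}). Moreover, such (ν, β) are unique. -/

import Mathlib

open scoped BigOperators
open Filter Topology

noncomputable section

variable {I S : Type} [Fintype I] [DecidableEq I] [Fintype S]

/-- The configuration `e_i` consisting of a single type-`i` customer. -/
def econf (i : I) : I → ℕ := Pi.single i 1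

/-- `K^s`: the set of nonzero configurations of server type `s`. -/
def Kc (Kbar : S → Finset (I → ℕ)) (s : S) : Finset (I → ℕ) := (Kbar s).erase 0

/-- Monotonicity of the configuration sets. -/
def KbarMono (Kbar : S → Finset (I → ℕ)) : Prop :=
  ∀ s, ∀ k ∈ Kbar s, ∀ k' : I → ℕ, (∀ i, k' i ≤ k i) → k' ∈ Kbar s

/-- Each configuration set contains the zero configuration. -/
def KbarZero (Kbar : S → Finset (I → ℕ)) : Prop := ∀ s, (0 : I → ℕ) ∈ Kbar s

/-- Every customer type can be served by some server type. -/
def KbarServe (Kbar : S → Finset (I → ℕ)) : Prop := ∀ i : I, ∃ s, econf i ∈ Kbar s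

/-- `ℝ_+^K`: nonnegative vectors supported on the nonzero configurations. -/
def orthK (Kbar : S → Finset (I → ℕ)) : Set (S → (I → ℕ) → ℝ) :=
  {x | (∀ s k, 0 ≤ x s k) ∧ ∀ s, ∀ k, k ∉ Kc Kbar s → x s k = 0}

/-- The feasible set `X` (equality constraints). -/
def feasX (Kbar : S → Finset (I → ℕ)) (ρ : I → ℝ) : Set (S → (I → ℕ) → ℝ) :=
  {x | x ∈ orthK Kbar ∧ ∀ i, ∑ s, ∑ k ∈ Kc Kbar s, (k i : ℝ) * x s k = ρ i}

/-- The relaxed feasible set (inequality constraints). -/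
def feasXge (Kbar : S → Finset (I → ℕ)) (ρ : I → ℝ) : Set (S → (I → ℕ) → ℝ) :=
  {x | x ∈ orthK Kbar ∧ ∀ i, ρ i ≤ ∑ s, ∑ k ∈ Kc Kbar s, (k i : ℝ) * x s k}

/-- The weighted number of occupied servers. -/
def objW (Kbar : S → Finset (I → ℕ)) (γ : S → ℝ) (x : S → (I → ℕ) → ℝ) : ℝ :=
  ∑ s, ∑ k ∈ Kc Kbar s, γ s * x s k

/-- `X*`: optimal solutions of LP=. -/
def XstarSet (Kbar : S → Finset (I → ℕ)) (ρ : I → ℝ) (γ : S → ℝ) :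
    Set (S → (I → ℕ) → ℝ) :=
  {x | x ∈ feasX Kbar ρ ∧ ∀ y ∈ feasX Kbar ρ, objW Kbar γ x ≤ objW Kbar γ y}

/-- `X**`: optimal solutions of LP≤. -/
def XstarSetGe (Kbar : S → Finset (I → ℕ)) (ρ : I → ℝ) (γ : S → ℝ) :
    Set (S → (I → ℕ) → ℝ) :=
  {x | x ∈ feasXge Kbar ρ ∧ ∀ y ∈ feasXge Kbar ρ, objW Kbar γ x ≤ objW Kbar γ y}

/-- `H*`: dual optimal vectors. -/
def HstarSet (Kbar : S → Finset (I → ℕ)) (ρ : I → ℝ) (γ : S → ℝ) : Set (I → ℝ) :=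
  {η | ∃ x ∈ feasX Kbar ρ, (∀ i, 0 ≤ η i) ∧
    (∀ s, ∀ k ∈ Kc Kbar s, ∑ i, (k i : ℝ) * η i ≤ γ s) ∧
    (∀ s, ∀ k ∈ Kc Kbar s, (∑ i, (k i : ℝ) * η i) < γ s → x s k = 0)}

/-- `c_k = ∏_i k_i!`. -/
def ck (k : I → ℕ) : ℝ := ∏ i, (Nat.factorial (k i) : ℝ)

/-- The function `L^{(a)}`. -/
def Lfun (Kbar : S → Finset (I → ℕ)) (a : S → ℝ) (x : S → (I → ℕ) → ℝ) : ℝ :=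
  ∑ s, ∑ k ∈ Kc Kbar s, x s k * Real.log (x s k * ck k / (Real.exp 1 * a s))

/-- Product form (infinite-server system). -/
def prodForm (Kbar : S → Finset (I → ℕ)) (a : S → ℝ) (x : S → (I → ℕ) → ℝ)
    (ν : I → ℝ) : Prop :=
  ∀ s, ∀ k ∈ Kc Kbar s, x s k = a s / ck k * Real.exp (∑ i, (k i : ℝ) * ν i)

/-- ℓ¹ distance on the coordinates indexed by `K`. -/
def distK (Kbar : S → Finset (I → ℕ)) (x y : S → (I → ℕ) → ℝ) : ℝ :=
  ∑ s, ∑ k ∈ Kc Kbar s, |x s k - y s k|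

/-- Extended coordinate value: the zero configuration of type `s` has value `a_s`. -/
def xval (a : S → ℝ) (x : S → (I → ℕ) → ℝ) (s : S) (k : I → ℕ) : ℝ :=
  if k = 0 then a s else x s k

/-- `x_{(i)}`: amount of servers available to a type-`i` arrival (GRAND(aZ)). -/
def xavail (Kbar : S → Finset (I → ℕ)) (a : S → ℝ) (x : S → (I → ℕ) → ℝ) (i : I) : ℝ :=
  ∑ s, ((if econf i ∈ Kc Kbar s then a s else 0)
    + ∑ k ∈ (Kc Kbar s).filter (fun k => k + econf i ∈ Kbar s), x s k)

/-- Departure rate `w_{k i}`. -/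
def wrate (μ : I → ℝ) (x : S → (I → ℕ) → ℝ) (s : S) (k : I → ℕ) (i : I) : ℝ :=
  (k i : ℝ) * μ i * x s k

/-- Arrival rate `v_{k i}` (GRAND(aZ)), with `λ_i = μ_i ρ_i`. -/
def vrate (Kbar : S → Finset (I → ℕ)) (a : S → ℝ) (μ ρ : I → ℝ)
    (x : S → (I → ℕ) → ℝ) (s : S) (k : I → ℕ) (i : I) : ℝ :=
  μ i * ρ i * xval a x s (k - econf i) / xavail Kbar a x i

/-- The GRAND(aZ) fluid vector field `F_k(x)`, for `k ∈ K^s`. -/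
def Fdrift (Kbar : S → Finset (I → ℕ)) (a : S → ℝ) (μ ρ : I → ℝ)
    (x : S → (I → ℕ) → ℝ) (s : S) (k : I → ℕ) : ℝ :=
  (∑ i ∈ Finset.univ.filter (fun i : I => 1 ≤ k i ∧ k - econf i ∈ Kbar s),
    (vrate Kbar a μ ρ x s k i - wrate μ x s k i))
  - ∑ i ∈ Finset.univ.filter (fun i : I => k + econf i ∈ Kbar s),
    (vrate Kbar a μ ρ x s (k + econf i) i - wrate μ x s (k + econf i) i)

/-- The function `Ξ(x)` (GRAND(aZ)). -/
def Xi (Kbar : S → Finset (I → ℕ)) (a : S → ℝ) (μ : I → ℝ)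
    (x : S → (I → ℕ) → ℝ) : ℝ :=
  ∑ i : I, ∑ s : S,
    ∑ k ∈ (Kc Kbar s).filter (fun k => 1 ≤ k i ∧ k - econf i ∈ Kbar s),
      ∑ s' : S,
        ∑ k' ∈ (Kc Kbar s').filter (fun k' => 1 ≤ k' i ∧ k' - econf i ∈ Kbar s'),
          (Real.log ((k' i : ℝ) * xval a x s (k - econf i) * x s' k')
            - Real.log ((k i : ℝ) * x s k * xval a x s' (k' - econf i)))
          * ((k i : ℝ) * μ i * x s k * xval a x s' (k' - econf i) / xavail Kbar a x i)

open Classical in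
/-- `Ξ` extended by `−∞` to points with a vanishing coordinate, as a map into `[−∞, 0] ⊆ EReal`. -/
def XiE (Kbar : S → Finset (I → ℕ)) (a : S → ℝ) (μ : I → ℝ)
    (x : S → (I → ℕ) → ℝ) : EReal :=
  if ∀ s, ∀ k ∈ Kc Kbar s, 0 < x s k then ((Xi Kbar a μ x : ℝ) : EReal) else ⊥

/-! Finite-server (GRAND-F) objects. -/

/-- `X^□`. -/
def XBox (Kbar : S → Finset (I → ℕ)) (h : S → ℝ) : Set (S → (I → ℕ) → ℝ) :=
  {x | x ∈ orthK Kbar ∧ ∀ s, ∑ k ∈ Kc Kbar s, x s k ≤ h s}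

/-- `x_{0^s} = h_s − Σ_{k∈K^s} x_k`. -/
def x0 (Kbar : S → Finset (I → ℕ)) (h : S → ℝ) (x : S → (I → ℕ) → ℝ) (s : S) : ℝ :=
  h s - ∑ k ∈ Kc Kbar s, x s k

/-- `X^⋄ = X^□ ∩ X`. -/
def XDiamond (Kbar : S → Finset (I → ℕ)) (h : S → ℝ) (ρ : I → ℝ) :
    Set (S → (I → ℕ) → ℝ) := XBox Kbar h ∩ feasX Kbar ρ

/-- Assumption A: a feasible point with idle servers of every type. -/
def AssumptionA (Kbar : S → Finset (I → ℕ)) (h : S → ℝ) (ρ : I → ℝ) : Prop :=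
  ∃ x ∈ XDiamond Kbar h ρ, ∀ s, 0 < x0 Kbar h x s

/-- The function `L^□`. -/
def LBox (Kbar : S → Finset (I → ℕ)) (h : S → ℝ) (x : S → (I → ℕ) → ℝ) : ℝ :=
  ∑ s, (x0 Kbar h x s * Real.log (x0 Kbar h x s / Real.exp 1)
    + ∑ k ∈ Kc Kbar s, x s k * Real.log (x s k * ck k / Real.exp 1))

/-- Product form (finite-server system), including the zero configurations. -/
def prodFormBox (Kbar : S → Finset (I → ℕ)) (h : S → ℝ) (x : S → (I → ℕ) → ℝ)
    (ν : I → ℝ) (β : S → ℝ) : Prop :=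
  ∀ s, x0 Kbar h x s = Real.exp (-β s) ∧
    ∀ k ∈ Kc Kbar s, x s k = Real.exp (-β s) / ck k * Real.exp (∑ i, (k i : ℝ) * ν i)

/-- Extended coordinate value for the finite-server system. -/
def xvalBox (Kbar : S → Finset (I → ℕ)) (h : S → ℝ) (x : S → (I → ℕ) → ℝ)
    (s : S) (k : I → ℕ) : ℝ :=
  if k = 0 then x0 Kbar h x s else x s k

/-- `x_{(i)}` for the finite-server system (zero configurations included). -/
def xavailBox (Kbar : S → Finset (I → ℕ)) (h : S → ℝ) (x : S → (I → ℕ) → ℝ)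
    (i : I) : ℝ :=
  ∑ s, ((if econf i ∈ Kc Kbar s then x0 Kbar h x s else 0)
    + ∑ k ∈ (Kc Kbar s).filter (fun k => k + econf i ∈ Kbar s), x s k)

/-- Arrival rate `v_{k i}` (GRAND-F), with `λ_i = μ_i ρ_i`. -/
def vrateBox (Kbar : S → Finset (I → ℕ)) (h : S → ℝ) (μ ρ : I → ℝ)
    (x : S → (I → ℕ) → ℝ) (s : S) (k : I → ℕ) (i : I) : ℝ :=
  μ i * ρ i * xvalBox Kbar h x s (k - econf i) / xavailBox Kbar h x i

/-- The GRAND-F fluid vector field `F^□_k(x)`, for `k ∈ K^s`. -/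
def FdriftBox (Kbar : S → Finset (I → ℕ)) (h : S → ℝ) (μ ρ : I → ℝ)
    (x : S → (I → ℕ) → ℝ) (s : S) (k : I → ℕ) : ℝ :=
  (∑ i ∈ Finset.univ.filter (fun i : I => 1 ≤ k i ∧ k - econf i ∈ Kbar s),
    (vrateBox Kbar h μ ρ x s k i - wrate μ x s k i))
  - ∑ i ∈ Finset.univ.filter (fun i : I => k + econf i ∈ Kbar s),
    (vrateBox Kbar h μ ρ x s (k + econf i) i - wrate μ x s (k + econf i) i)

/-- The function `Ξ^□(x̄)`. -/
def XiBox (Kbar : S → Finset (I → ℕ)) (h : S → ℝ) (μ : I → ℝ)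
    (x : S → (I → ℕ) → ℝ) : ℝ :=
  ∑ i : I, ∑ s : S,
    ∑ k ∈ (Kc Kbar s).filter (fun k => 1 ≤ k i ∧ k - econf i ∈ Kbar s),
      ∑ s' : S,
        ∑ k' ∈ (Kc Kbar s').filter (fun k' => 1 ≤ k' i ∧ k' - econf i ∈ Kbar s'),
          (Real.log ((k' i : ℝ) * xvalBox Kbar h x s (k - econf i) * x s' k')
            - Real.log ((k i : ℝ) * x s k * xvalBox Kbar h x s' (k' - econf i)))
          * ((k i : ℝ) * μ i * x s k * xvalBox Kbar h x s' (k' - econf i)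
              / xavailBox Kbar h x i)

/-- Gradient inequality for the convex function `y ↦ y log (y c / e)`. -/
lemma mul_log_gradient_le {p y c : ℝ} (hp : 0 < p) (hy : 0 ≤ y) (hc : 0 < c) :
    p * Real.log (p * c / Real.exp 1) + Real.log (p * c) * (y - p)
      ≤ y * Real.log (y * c / Real.exp 1) := by
  have hlog : ∀ z : ℝ, 0 < z →
      Real.log (z * c / Real.exp 1) = Real.log z + Real.log c - 1 := by
    intro z hz
    rw [Real.log_div (by positivity) (by positivity), Real.log_mul hz.ne' hc.ne', Real.log_exp]
  rw [hlog p hp, Real.log_mul hp.ne' hc.ne']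
  rcases hy.eq_or_lt with rfl | hy
  · nlinarith
  · rw [hlog y hy]
    have h1 := Real.log_le_sub_one_of_pos (div_pos hp hy)
    rw [Real.log_div hp.ne' hy.ne'] at h1
    have h2 := mul_le_mul_of_nonneg_left h1 hy.le
    have h3 : y * (p / y - 1) = p - y := by field_simp
    nlinarith

section Entropy

variable {ι J : Type*} [Fintype ι]

/-- The entropy-type functional `∑ p log (p c / e)`. -/
def weightedEntropy (c p : ι → ℝ) : ℝ := ∑ m, p m * Real.log (p m * c m / Real.exp 1)

lemma weightedEntropy_gradient_le {c p y : ι → ℝ} (hc : ∀ m, 0 < c m) (hp : ∀ m, 0 < p m)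
    (hy : ∀ m, 0 ≤ y m) :
    weightedEntropy c p + ∑ m, Real.log (p m * c m) * (y m - p m) ≤ weightedEntropy c y := by
  unfold weightedEntropy
  rw [← Finset.sum_add_distrib]
  exact Finset.sum_le_sum fun m _ => mul_log_gradient_le (hp m) (hy m) (hc m)

/-- The points of the polyhedron `{p ≥ 0 | a p = b}`. -/
def nonnegSolutions (a : J → ι → ℝ) (b : J → ℝ) : Set (ι → ℝ) :=
  {p | (∀ m, 0 ≤ p m) ∧ ∀ j, ∑ m, a j m * p m = b j}

variable {a : J → ι → ℝ} {b : J → ℝ} {c p : ι → ℝ}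

lemma weightedEntropy_le_of_log_eq [Fintype J] (hc : ∀ m, 0 < c m) (hp : p ∈ nonnegSolutions a b)
    (hpos : ∀ m, 0 < p m) {l : J → ℝ} (hl : ∀ m, Real.log (p m * c m) = ∑ j, l j * a j m)
    {y : ι → ℝ} (hy : y ∈ nonnegSolutions a b) :
    weightedEntropy c p ≤ weightedEntropy c y := by
  have h1 := weightedEntropy_gradient_le hc hpos hy.1
  have h2 : ∑ m, Real.log (p m * c m) * (y m - p m) = 0 := by
    simp_rw [hl, Finset.sum_mul]
    rw [Finset.sum_comm]
    refine Finset.sum_eq_zero fun j _ => ?_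
    simp_rw [mul_assoc, mul_sub]
    rw [Finset.sum_sub_distrib, ← Finset.mul_sum, ← Finset.mul_sum, hy.2, hp.2, sub_self]
  linarith

lemma pos_of_minimizer_weightedEntropy (hc : ∀ m, 0 < c m) (hp : p ∈ nonnegSolutions a b)
    (hmin : ∀ y ∈ nonnegSolutions a b, weightedEntropy c p ≤ weightedEntropy c y)
    {z : ι → ℝ} (hz : z ∈ nonnegSolutions a b) (hzpos : ∀ m, 0 < z m) (m₀ : ι) :
    0 < p m₀ := by
  by_contra hneg
  have hp0 : p m₀ = 0 := le_antisymm (not_lt.mp hneg) (hp.1 m₀)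
  set B := ∑ m, Real.log (z m * c m) * (z m - p m)
  obtain ⟨t, ht0, ht1, htB⟩ : ∃ t : ℝ, 0 < t ∧ t ≤ 1 ∧ B + Real.log t * z m₀ < 0 := by
    refine ⟨Real.exp (-((|B| + 1) / z m₀)), Real.exp_pos _, ?_, ?_⟩
    · rw [Real.exp_le_one_iff]
      have := hzpos m₀
      have : 0 ≤ (|B| + 1) / z m₀ := by positivity
      linarith
    · rw [Real.log_exp, neg_mul, div_mul_cancel₀ _ (hzpos m₀).ne']
      linarith [le_abs_self B]
  set q : ι → ℝ := fun m => p m + t * (z m - p m) with hq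
  have hqpos : ∀ m, 0 < q m := fun m => by
    have := mul_pos ht0 (hzpos m)
    have := mul_nonneg (sub_nonneg.2 ht1) (hp.1 m)
    simp only [hq]; linarith
  have hqmem : q ∈ nonnegSolutions a b := by
    refine ⟨fun m => (hqpos m).le, fun j => ?_⟩
    have : ∀ m, a j m * q m = a j m * p m + t * (a j m * z m - a j m * p m) := fun m => by
      simp only [hq]; ring
    simp_rw [this]
    rw [Finset.sum_add_distrib, ← Finset.mul_sum, Finset.sum_sub_distrib, hz.2, hp.2]
    ring
  have h1 := weightedEntropy_gradient_le hc hqpos hp.1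
  have h2 := hmin q hqmem
  have h3 : ∑ m, Real.log (q m * c m) * (p m - q m)
      = -(t * ∑ m, Real.log (q m * c m) * (z m - p m)) := by
    rw [Finset.mul_sum, ← Finset.sum_neg_distrib]
    refine Finset.sum_congr rfl fun m _ => ?_
    simp only [hq]; ring
  have h4 : 0 ≤ ∑ m, Real.log (q m * c m) * (z m - p m) := by
    by_contra hlt
    have := mul_neg_of_pos_of_neg ht0 (not_le.mp hlt)
    linarith
  classical
  have h5 : ∑ m, Real.log (q m * c m) * (z m - p m)
      ≤ ∑ m, (Real.log (z m * c m) * (z m - p m)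
        + if m = m₀ then Real.log t * z m₀ else 0) := by
    refine Finset.sum_le_sum fun m _ => ?_
    split_ifs with hm
    · subst hm
      have : q m = t * z m := by simp only [hq, hp0]; ring
      rw [this, hp0, mul_assoc, Real.log_mul ht0.ne' (mul_pos (hzpos m) (hc m)).ne']
      linarith
    · rw [add_zero]
      have hs : (1 - t) * (z m - p m) = z m - q m := by simp only [hq]; ring
      rcases le_total 0 (z m - p m) with hd | hd
      · have := mul_nonneg (sub_nonneg.2 ht1) hd
        exact mul_le_mul_of_nonneg_right (Real.log_le_log (mul_pos (hqpos m) (hc m))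
          (mul_le_mul_of_nonneg_right (by linarith) (hc m).le)) hd
      · have := mul_nonpos_of_nonneg_of_nonpos (sub_nonneg.2 ht1) hd
        exact mul_le_mul_of_nonpos_right (Real.log_le_log (mul_pos (hzpos m) (hc m))
          (mul_le_mul_of_nonneg_right (by linarith) (hc m).le)) hd
  rw [Finset.sum_add_distrib, Finset.sum_ite_eq' Finset.univ m₀] at h5
  simp only [Finset.mem_univ, if_true] at h5
  linarith

lemma log_mul_nonneg_of_minimizer (hc : ∀ m, 0 < c m) (hp : p ∈ nonnegSolutions a b)
    (hpos : ∀ m, 0 < p m)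
    (hmin : ∀ y ∈ nonnegSolutions a b, weightedEntropy c p ≤ weightedEntropy c y)
    {d : ι → ℝ} (hd : ∀ j, ∑ m, a j m * d m = 0) :
    0 ≤ ∑ m, Real.log (p m * c m) * d m := by
  have hlim : Tendsto (fun t : ℝ => ∑ m, Real.log ((p m + t * d m) * c m) * d m) (𝓝[>] 0)
      (𝓝 (∑ m, Real.log (p m * c m) * d m)) := by
    refine tendsto_nhdsWithin_of_tendsto_nhds (tendsto_finsetSum _ fun m _ => ?_)
    have hcont : ContinuousAt (fun t : ℝ => Real.log ((p m + t * d m) * c m) * d m) 0 := by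
      refine ContinuousAt.mul (ContinuousAt.log (by fun_prop) ?_) continuousAt_const
      simpa using ⟨(hpos m).ne', (hc m).ne'⟩
    simpa [ContinuousAt] using hcont
  have hev : ∀ᶠ t : ℝ in 𝓝[>] 0, ∀ m, 0 < p m + t * d m := by
    refine eventually_all.2 fun m => ?_
    have hcont : ContinuousAt (fun t : ℝ => p m + t * d m) 0 := by fun_prop
    exact (hcont.eventually_const_lt (by simpa using hpos m)).filter_mono nhdsWithin_le_nhds
  refine ge_of_tendsto hlim ?_
  filter_upwards [hev, self_mem_nhdsWithin] with t ht ht0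
  have ht0 : 0 < t := ht0
  have hmem : (fun m => p m + t * d m) ∈ nonnegSolutions a b := by
    refine ⟨fun m => (ht m).le, fun j => ?_⟩
    have : ∀ m, a j m * (p m + t * d m) = a j m * p m + t * (a j m * d m) := fun m => by ring
    simp_rw [this]
    rw [Finset.sum_add_distrib, ← Finset.mul_sum, hd, hp.2, mul_zero, add_zero]
  have h1 := weightedEntropy_gradient_le hc ht hp.1
  have h2 := hmin _ hmem
  have h3 : ∑ m, Real.log ((p m + t * d m) * c m) * (p m - (p m + t * d m))
      = -(t * ∑ m, Real.log ((p m + t * d m) * c m) * d m) := by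
    rw [Finset.mul_sum, ← Finset.sum_neg_distrib]
    exact Finset.sum_congr rfl fun m _ => by ring
  by_contra hlt
  have := mul_neg_of_pos_of_neg ht0 (not_le.mp hlt)
  linarith

lemma exists_log_eq_of_minimizer [Fintype J] (hc : ∀ m, 0 < c m)
    (hp : p ∈ nonnegSolutions a b) (hpos : ∀ m, 0 < p m)
    (hmin : ∀ y ∈ nonnegSolutions a b, weightedEntropy c p ≤ weightedEntropy c y) :
    ∃ l : J → ℝ, ∀ m, Real.log (p m * c m) = ∑ j, l j * a j m := by
  classical
  let F : (ι → ℝ) → ((ι → ℝ) →ₗ[ℝ] ℝ) := fun v => ∑ m, v m • LinearMap.proj m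
  have hF : ∀ v d, F v d = ∑ m, v m * d m := fun v d => by simp [F]
  have hspan : F (fun m => Real.log (p m * c m)) ∈
      Submodule.span ℝ (Set.range fun j => F (a j)) := by
    refine mem_span_of_iInf_ker_le_ker fun d hd => ?_
    simp only [Submodule.mem_iInf, LinearMap.mem_ker, hF] at hd ⊢
    have h1 := log_mul_nonneg_of_minimizer hc hp hpos hmin hd
    have h2 := log_mul_nonneg_of_minimizer hc hp hpos hmin (d := fun m => -d m)
      (fun j => by simp [hd j])
    simp only [mul_neg, Finset.sum_neg_distrib] at h2
    linarith
  obtain ⟨l, hl⟩ := (Submodule.mem_span_range_iff_exists_fun ℝ).1 hspan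
  refine ⟨l, fun m => ?_⟩
  have := congrArg (fun f => f (Pi.single m 1)) hl
  simpa [hF, Pi.single_apply] using this.symm

end Entropy

lemma ck_pos (k : I → ℕ) : 0 < ck k :=
  Finset.prod_pos fun i _ => by exact_mod_cast Nat.factorial_pos (k i)

lemma ck_zero : ck (0 : I → ℕ) = 1 := by simp [ck]

lemma ck_econf (i : I) : ck (econf i) = 1 := by
  refine Finset.prod_eq_one fun j _ => ?_
  by_cases hj : j = i
  · subst hj; simp [econf]
  · simp [econf, hj]

lemma econf_ne_zero (i : I) : econf i ≠ 0 := fun h => by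
  simpa [econf] using congrFun h i

lemma ne_zero_of_mem_Kc {Kbar : S → Finset (I → ℕ)} {s : S} {k : I → ℕ} (hk : k ∈ Kc Kbar s) :
    k ≠ 0 := (Finset.mem_erase.1 hk).1

/-- The pairs `(s, k)` with `k ∈ K̄^s`. -/
abbrev Conf (Kbar : S → Finset (I → ℕ)) : Type := Σ s, {k // k ∈ Kbar s}

lemma sum_conf {Kbar : S → Finset (I → ℕ)} (hzero : KbarZero Kbar) (f : S → (I → ℕ) → ℝ) :
    ∑ m : Conf Kbar, f m.1 m.2 = ∑ s, (f s 0 + ∑ k ∈ Kc Kbar s, f s k) := by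
  rw [Fintype.sum_sigma]
  refine Finset.sum_congr rfl fun s _ => ?_
  rw [Finset.sum_coe_sort (Kbar s) (f s), Kc, Finset.add_sum_erase _ _ (hzero s)]

/-- The extended vector `x̄`, as a function on `Conf Kbar`. -/
def extend (Kbar : S → Finset (I → ℕ)) (h : S → ℝ) (x : S → (I → ℕ) → ℝ) (m : Conf Kbar) : ℝ :=
  xvalBox Kbar h x m.1 m.2

lemma xvalBox_zero (Kbar : S → Finset (I → ℕ)) (h : S → ℝ) (x : S → (I → ℕ) → ℝ) (s : S) :
    xvalBox Kbar h x s 0 = x0 Kbar h x s := if_pos rfl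

lemma xvalBox_of_mem {Kbar : S → Finset (I → ℕ)} {s : S} {k : I → ℕ} (hk : k ∈ Kc Kbar s)
    (h : S → ℝ) (x : S → (I → ℕ) → ℝ) : xvalBox Kbar h x s k = x s k :=
  if_neg (ne_zero_of_mem_Kc hk)

/-- Coefficients of the customer and pool-size constraints on `x̄`. -/
def constraintCoeff [DecidableEq S] (Kbar : S → Finset (I → ℕ)) : I ⊕ S → Conf Kbar → ℝ
  | .inl i, m => (m.2 : I → ℕ) i
  | .inr s, m => if m.1 = s then 1 else 0

lemma LBox_eq_weightedEntropy {Kbar : S → Finset (I → ℕ)} (hzero : KbarZero Kbar) (h : S → ℝ)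
    (x : S → (I → ℕ) → ℝ) :
    LBox Kbar h x = weightedEntropy (fun m : Conf Kbar => ck (m.2 : I → ℕ)) (extend Kbar h x) := by
  unfold weightedEntropy LBox extend
  rw [sum_conf hzero fun s k =>
    xvalBox Kbar h x s k * Real.log (xvalBox Kbar h x s k * ck k / Real.exp 1)]
  refine Finset.sum_congr rfl fun s _ => ?_
  rw [xvalBox_zero, ck_zero, mul_one]
  congr 1
  exact Finset.sum_congr rfl fun k hk => by rw [xvalBox_of_mem hk]

lemma sum_inl_extend [DecidableEq S] {Kbar : S → Finset (I → ℕ)} (hzero : KbarZero Kbar)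
    (h : S → ℝ) (x : S → (I → ℕ) → ℝ) (i : I) :
    ∑ m, constraintCoeff Kbar (.inl i) m * extend Kbar h x m
      = ∑ s, ∑ k ∈ Kc Kbar s, (k i : ℝ) * x s k := by
  unfold extend
  simp only [constraintCoeff]
  rw [sum_conf hzero fun s k => (k i : ℝ) * xvalBox Kbar h x s k]
  refine Finset.sum_congr rfl fun s _ => ?_
  simp only [Pi.zero_apply, Nat.cast_zero, zero_mul, zero_add]
  exact Finset.sum_congr rfl fun k hk => by rw [xvalBox_of_mem hk]

lemma sum_inr_extend [DecidableEq S] {Kbar : S → Finset (I → ℕ)} (hzero : KbarZero Kbar)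
    (h : S → ℝ) (x : S → (I → ℕ) → ℝ) (s : S) :
    ∑ m, constraintCoeff Kbar (.inr s) m * extend Kbar h x m = h s := by
  unfold extend
  simp only [constraintCoeff]
  rw [sum_conf hzero fun s' k => (if s' = s then (1 : ℝ) else 0) * xvalBox Kbar h x s' k]
  simp_rw [← Finset.mul_sum, ← mul_add, ite_mul, one_mul, zero_mul]
  rw [Finset.sum_ite_eq' Finset.univ s]
  simp only [Finset.mem_univ, if_true, xvalBox_zero]
  rw [Finset.sum_congr rfl fun k hk => xvalBox_of_mem hk h x, x0]
  ring

lemma extend_mem_nonnegSolutions [DecidableEq S] {Kbar : S → Finset (I → ℕ)}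
    (hzero : KbarZero Kbar) {h : S → ℝ} {ρ : I → ℝ} {x : S → (I → ℕ) → ℝ}
    (hx : x ∈ XDiamond Kbar h ρ) :
    extend Kbar h x ∈ nonnegSolutions (constraintCoeff Kbar) (Sum.elim ρ h) := by
  refine ⟨fun m => ?_, ?_⟩
  · unfold extend xvalBox
    split_ifs
    · exact sub_nonneg.2 (hx.1.2 _)
    · exact hx.1.1.1 _ _
  · rintro (i | s)
    · rw [sum_inl_extend hzero, hx.2.2, Sum.elim_inl]
    · rw [sum_inr_extend hzero, Sum.elim_inr]

lemma exists_extend_eq [DecidableEq S] {Kbar : S → Finset (I → ℕ)}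
    (hzero : KbarZero Kbar) {h : S → ℝ} {ρ : I → ℝ} {q : Conf Kbar → ℝ}
    (hq : q ∈ nonnegSolutions (constraintCoeff Kbar) (Sum.elim ρ h)) :
    ∃ y ∈ XDiamond Kbar h ρ, extend Kbar h y = q := by
  classical
  let g : S → (I → ℕ) → ℝ := fun s k => if hk : k ∈ Kbar s then q ⟨s, k, hk⟩ else 0
  have hg : ∀ m : Conf Kbar, g m.1 m.2 = q m := fun m => dif_pos m.2.2
  have hg0 : ∀ s k, 0 ≤ g s k := fun s k => by
    simp only [g]; split_ifs
    · exact hq.1 _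
    · exact le_rfl
  let y : S → (I → ℕ) → ℝ := fun s k => if k = 0 then 0 else g s k
  have hyK : ∀ s, ∀ k ∈ Kc Kbar s, y s k = g s k := fun s k hk => if_neg (ne_zero_of_mem_Kc hk)
  have hpool : ∀ s, x0 Kbar h y s = g s 0 := fun s => by
    have h1 := hq.2 (.inr s)
    simp_rw [← hg, constraintCoeff] at h1
    rw [sum_conf hzero fun s' k => (if s' = s then (1 : ℝ) else 0) * g s' k] at h1
    simp_rw [← Finset.mul_sum, ← mul_add, ite_mul, one_mul, zero_mul] at h1
    rw [Finset.sum_ite_eq' Finset.univ s] at h1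
    simp only [Finset.mem_univ, if_true, Sum.elim_inr] at h1
    rw [x0, Finset.sum_congr rfl (hyK s), ← h1]
    ring
  have hext : extend Kbar h y = q := by
    funext m
    rw [← hg m, extend, xvalBox]
    split_ifs with hm
    · rw [hpool, hm]
    · exact if_neg hm
  have horth : y ∈ orthK Kbar := by
    refine ⟨fun s k => ?_, fun s k hk => ?_⟩
    · simp only [y]; split_ifs
      · exact le_rfl
      · exact hg0 s k
    · simp only [y]; split_ifs with hk0
      · rfl
      · exact dif_neg fun hm => hk (Finset.mem_erase.2 ⟨hk0, hm⟩)
  refine ⟨y, ⟨⟨horth, fun s => ?_⟩, horth, fun i => ?_⟩, hext⟩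
  · have := hg0 s 0
    rw [← hpool, x0] at this
    linarith
  · rw [← sum_inl_extend hzero h, hext, hq.2, Sum.elim_inl]

/-- There is a vector, positive on all of `K`, whose customer loads are a multiple of `ρ`. -/
lemma exists_pos_load_eq_mul {Kbar : S → Finset (I → ℕ)} (hserve : KbarServe Kbar)
    {ρ : I → ℝ} (hρ : ∀ i, 0 < ρ i) :
    ∃ (M : ℝ) (w : S → (I → ℕ) → ℝ), (∀ s k, 0 < w s k) ∧
      ∀ i, ∑ s, ∑ k ∈ Kc Kbar s, (k i : ℝ) * w s k = M * ρ i := by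
  classical
  choose σ hσ using hserve
  have hσ' : ∀ i, econf i ∈ Kc Kbar (σ i) := fun i =>
    Finset.mem_erase.2 ⟨econf_ne_zero i, hσ i⟩
  let N : I → ℝ := fun i => ∑ s, ∑ k ∈ Kc Kbar s, (k i : ℝ)
  obtain ⟨M, hM⟩ := (Set.finite_range fun i => N i / ρ i).bddAbove
  have hM' : ∀ i, 0 ≤ M * ρ i - N i := fun i => by
    have := (div_le_iff₀ (hρ i)).1 (hM ⟨i, rfl⟩)
    linarith
  refine ⟨M, fun s k => 1 + ∑ j, if s = σ j then if k = econf j then M * ρ j - N j else 0 else 0,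
    fun s k => ?_, fun i => ?_⟩
  · refine add_pos_of_pos_of_nonneg one_pos (Finset.sum_nonneg fun j _ => ?_)
    split_ifs
    · exact hM' j
    · exact le_rfl
    · exact le_rfl
  · have hterm : ∀ j, ∑ s, ∑ k ∈ Kc Kbar s, (k i : ℝ) *
        (if s = σ j then if k = econf j then M * ρ j - N j else 0 else 0)
          = if i = j then M * ρ j - N j else 0 := fun j => by
      rw [Finset.sum_eq_single (σ j), Finset.sum_eq_single (econf j)]
      · simp [econf, Pi.single_apply]
      · intro k _ hk; simp [hk]
      · intro hk; exact absurd (hσ' j) hk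
      · intro s _ hs; simp [hs]
      · intro hs; exact absurd (Finset.mem_univ _) hs
    simp_rw [mul_add, mul_one, Finset.sum_add_distrib, Finset.mul_sum]
    have hswap : ∑ s, ∑ k ∈ Kc Kbar s, ∑ j, (k i : ℝ) *
        (if s = σ j then if k = econf j then M * ρ j - N j else 0 else 0)
          = ∑ j, ∑ s, ∑ k ∈ Kc Kbar s, (k i : ℝ) *
        (if s = σ j then if k = econf j then M * ρ j - N j else 0 else 0) := by
      rw [Finset.sum_comm]
      exact Finset.sum_congr rfl fun s _ => Finset.sum_comm
    rw [hswap, Finset.sum_congr rfl fun j _ => hterm j, Finset.sum_ite_eq Finset.univ i]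
    simp only [Finset.mem_univ, if_true, N]
    ring

/-- Under Assumption A some feasible point has all coordinates of `x̄` positive. -/
lemma exists_pos_mem_XDiamond {Kbar : S → Finset (I → ℕ)} (hserve : KbarServe Kbar)
    {ρ : I → ℝ} (hρ : ∀ i, 0 < ρ i) {h : S → ℝ} (hA : AssumptionA Kbar h ρ) :
    ∃ z ∈ XDiamond Kbar h ρ, ∀ m, 0 < extend Kbar h z m := by
  classical
  obtain ⟨y, hy, hy0⟩ := hA
  obtain ⟨M, w, hw, hload⟩ := exists_pos_load_eq_mul hserve hρ
  let z : ℝ → S → (I → ℕ) → ℝ := fun ε s k =>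
    if k ∈ Kc Kbar s then (1 - ε * M) * y s k + ε * w s k else 0
  have hzK : ∀ ε s, ∀ k ∈ Kc Kbar s, z ε s k = (1 - ε * M) * y s k + ε * w s k :=
    fun ε s k hk => if_pos hk
  have hx0 : ∀ ε s, x0 Kbar h (z ε) s
      = h s - ∑ k ∈ Kc Kbar s, ((1 - ε * M) * y s k + ε * w s k) := fun ε s => by
    rw [x0, Finset.sum_congr rfl (hzK ε s)]
  have hev₁ : ∀ᶠ ε : ℝ in 𝓝[>] 0, 0 < 1 - ε * M := by
    have hcont : ContinuousAt (fun ε : ℝ => 1 - ε * M) 0 := by fun_prop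
    exact (hcont.eventually_const_lt (by simp)).filter_mono nhdsWithin_le_nhds
  have hev₂ : ∀ᶠ ε : ℝ in 𝓝[>] 0, ∀ s, 0 < x0 Kbar h (z ε) s := by
    refine eventually_all.2 fun s => ?_
    simp_rw [hx0]
    have hcont : ContinuousAt
        (fun ε : ℝ => h s - ∑ k ∈ Kc Kbar s, ((1 - ε * M) * y s k + ε * w s k)) 0 := by fun_prop
    exact (hcont.eventually_const_lt (by simpa [x0] using hy0 s)).filter_mono nhdsWithin_le_nhds
  obtain ⟨ε, hε₁, hε₂, hε⟩ := (hev₁.and (hev₂.and self_mem_nhdsWithin)).exists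
  have hε : 0 < ε := hε
  have hpos : ∀ s, ∀ k ∈ Kc Kbar s, 0 < z ε s k := fun s k hk => by
    rw [hzK ε s k hk]
    exact add_pos_of_nonneg_of_pos (mul_nonneg hε₁.le (hy.1.1.1 s k)) (mul_pos hε (hw s k))
  have horth : z ε ∈ orthK Kbar := by
    refine ⟨fun s k => ?_, fun s k hk => if_neg hk⟩
    by_cases hk : k ∈ Kc Kbar s
    · exact (hpos s k hk).le
    · exact (if_neg hk).ge
  refine ⟨z ε, ⟨⟨horth, fun s => ?_⟩, horth, fun i => ?_⟩, fun m => ?_⟩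
  · have := hε₂ s
    rw [x0] at this
    linarith
  · have hsplit : ∀ s, ∑ k ∈ Kc Kbar s, (k i : ℝ) * z ε s k
        = (1 - ε * M) * ∑ k ∈ Kc Kbar s, (k i : ℝ) * y s k
          + ε * ∑ k ∈ Kc Kbar s, (k i : ℝ) * w s k := fun s => by
      rw [Finset.mul_sum, Finset.mul_sum, ← Finset.sum_add_distrib]
      exact Finset.sum_congr rfl fun k hk => by rw [hzK ε s k hk]; ring
    simp_rw [hsplit]
    rw [Finset.sum_add_distrib, ← Finset.mul_sum, ← Finset.mul_sum, hload, hy.2.2]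
    ring
  · unfold extend xvalBox
    split_ifs with hm
    · exact hε₂ _
    · exact hpos _ _ (Finset.mem_erase.2 ⟨hm, m.2.2⟩)

/-- The product form says that `log (x_k c_k)` is a combination of the constraint rows. -/
lemma prodFormBox_iff [DecidableEq S] {Kbar : S → Finset (I → ℕ)} (hzero : KbarZero Kbar)
    {h : S → ℝ} {x : S → (I → ℕ) → ℝ} {ν : I → ℝ} {β : S → ℝ} :
    prodFormBox Kbar h x ν β ↔ ∀ m : Conf Kbar, 0 < extend Kbar h x m ∧
      Real.log (extend Kbar h x m * ck (m.2 : I → ℕ))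
        = ∑ j, Sum.elim ν (fun s => -β s) j * constraintCoeff Kbar j m := by
  have hrow : ∀ m : Conf Kbar, ∑ j, Sum.elim ν (fun s => -β s) j * constraintCoeff Kbar j m
      = ∑ i, ((m.2 : I → ℕ) i : ℝ) * ν i + -β m.1 := fun m => by
    simp [constraintCoeff, Fintype.sum_sum_type, mul_comm]
  have hkey : ∀ (v : ℝ) (s : S) (k : I → ℕ),
      v = Real.exp (-β s) / ck k * Real.exp (∑ i, (k i : ℝ) * ν i) ↔
        0 < v ∧ Real.log (v * ck k) = ∑ i, (k i : ℝ) * ν i + -β s := fun v s k => by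
    have hk := ck_pos k
    constructor
    · rintro rfl
      refine ⟨by positivity, ?_⟩
      rw [show Real.exp (-β s) / ck k * Real.exp (∑ i, (k i : ℝ) * ν i) * ck k
        = Real.exp (∑ i, (k i : ℝ) * ν i + -β s) by rw [Real.exp_add]; field_simp, Real.log_exp]
    · rintro ⟨hv, hlog⟩
      rw [div_mul_eq_mul_div, eq_div_iff hk.ne', ← Real.exp_log (mul_pos hv hk), hlog,
        Real.exp_add, mul_comm]
  simp_rw [hrow, ← hkey]
  constructor
  · intro hpf m
    obtain ⟨s, k, hk⟩ := m
    by_cases hk0 : k = 0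
    · subst hk0
      simp [extend, xvalBox_zero, ck_zero, (hpf s).1]
    · have hk' : k ∈ Kc Kbar s := Finset.mem_erase.2 ⟨hk0, hk⟩
      rw [extend, xvalBox_of_mem hk']
      exact (hpf s).2 k hk'
  · intro hpf s
    refine ⟨?_, fun k hk => ?_⟩
    · simpa [extend, xvalBox_zero, ck_zero] using hpf ⟨s, 0, hzero s⟩
    · have := hpf ⟨s, k, (Finset.mem_erase.1 hk).2⟩
      rwa [extend, xvalBox_of_mem hk] at this

lemma prodFormBox_unique {Kbar : S → Finset (I → ℕ)} (hserve : KbarServe Kbar)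
    {h : S → ℝ} {x : S → (I → ℕ) → ℝ} {ν ν' : I → ℝ} {β β' : S → ℝ}
    (hpf : prodFormBox Kbar h x ν β) (hpf' : prodFormBox Kbar h x ν' β') :
    ν = ν' ∧ β = β' := by
  have hβ : β = β' := funext fun s =>
    neg_injective (Real.exp_injective ((hpf s).1.symm.trans (hpf' s).1))
  subst hβ
  refine ⟨funext fun i => ?_, rfl⟩
  obtain ⟨s, hs⟩ := hserve i
  have hs' : econf i ∈ Kc Kbar s := Finset.mem_erase.2 ⟨econf_ne_zero i, hs⟩
  have heq := ((hpf s).2 _ hs').symm.trans ((hpf' s).2 _ hs')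
  have hsum : ∀ μ : I → ℝ, ∑ j, (econf i j : ℝ) * μ j = μ i := fun μ => by
    simp [econf, Pi.single_apply]
  rw [ck_econf, div_one, hsum, hsum] at heq
  exact Real.exp_injective (mul_left_cancel₀ (Real.exp_pos _).ne' heq)

/-- product-form characterization of `x^{*,□}`, with uniqueness of `(ν, β)`. -/
theorem LBox_minimizer_iff_product_form
    (Kbar : S → Finset (I → ℕ))
    (hmono : KbarMono Kbar) (hzero : KbarZero Kbar) (hserve : KbarServe Kbar)
    (ρ : I → ℝ) (hρpos : ∀ i, 0 < ρ i) (hρsum : ∑ i, ρ i = 1)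
    (h : S → ℝ) (hhpos : ∀ s, 0 < h s)
    (hA : AssumptionA Kbar h ρ)
    (x : S → (I → ℕ) → ℝ) (hx : x ∈ XDiamond Kbar h ρ) :
    ((∀ y ∈ XDiamond Kbar h ρ, LBox Kbar h x ≤ LBox Kbar h y) ↔
        ∃ (ν : I → ℝ) (β : S → ℝ), prodFormBox Kbar h x ν β) ∧
    (∀ (ν : I → ℝ) (β : S → ℝ) (ν' : I → ℝ) (β' : S → ℝ),
      prodFormBox Kbar h x ν β → prodFormBox Kbar h x ν' β' → ν = ν' ∧ β = β') := by
  classical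
  refine ⟨⟨fun hmin => ?_, ?_⟩, fun _ _ _ _ => prodFormBox_unique hserve⟩
  · have hp := extend_mem_nonnegSolutions hzero hx
    have hmin' : ∀ q ∈ nonnegSolutions (constraintCoeff Kbar) (Sum.elim ρ h),
        weightedEntropy (fun m => ck (m.2 : I → ℕ)) (extend Kbar h x)
          ≤ weightedEntropy (fun m => ck (m.2 : I → ℕ)) q := by
      intro q hq
      obtain ⟨y, hy, rfl⟩ := exists_extend_eq hzero hq
      rw [← LBox_eq_weightedEntropy hzero, ← LBox_eq_weightedEntropy hzero]
      exact hmin y hy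
    have hc : ∀ m : Conf Kbar, 0 < ck (m.2 : I → ℕ) := fun m => ck_pos _
    obtain ⟨z, hz, hzpos⟩ := exists_pos_mem_XDiamond hserve hρpos hA
    have hpos := pos_of_minimizer_weightedEntropy hc hp hmin'
      (extend_mem_nonnegSolutions hzero hz) hzpos
    obtain ⟨l, hl⟩ := exists_log_eq_of_minimizer hc hp hpos hmin'
    refine ⟨fun i => l (.inl i), fun s => -l (.inr s),
      (prodFormBox_iff hzero).2 fun m => ⟨hpos m, ?_⟩⟩
    rw [hl m]
    simp [Fintype.sum_sum_type]
  · rintro ⟨ν, β, hpf⟩ y hy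
    have hpf' := (prodFormBox_iff hzero).1 hpf
    rw [LBox_eq_weightedEntropy hzero, LBox_eq_weightedEntropy hzero]
    exact weightedEntropy_le_of_log_eq (fun m => ck_pos _)
      (extend_mem_nonnegSolutions hzero hx) (fun m => (hpf' m).1) (fun m => (hpf' m).2)
      (extend_mem_nonnegSolutions hzero hy)
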